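/- arXiv:2601.23130 — 2 statements merged into one kernel-verified Lean document; each statement's English description precedes it below -/
import Mathlib

section
/- Let S = {(C₁,E₁,F₁,i₁,l₁),…,(C_n,E_n,F_n,i_n,l_n)} be a finite set of labelled nets over a common label set with pairwise disjoint sets of places and transitions, and let N = ({p},T,W,m₀) be a one-place marked Petri net such that every labelled net of S is enabled in N. Then there exists a token trail region r in S whose associated one-place Petri net N_r = ({p'},T,W',m₀') satisfies S ⊆ 𝓛(N_r) ⊆ 𝓛(N). -/
/-- A labelled net over label type `Λ` with places `C` and transitions `E`:
`arcIn c e` is the arc weight from place `c` to transition `e`,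
`arcOut e c` the arc weight from transition `e` to place `c`,
`i0` the initial marking, `lab` the labelling of transitions. -/
structure LNet (Λ C E : Type) where
  arcIn : C → E → ℕ
  arcOut : E → C → ℕ
  i0 : C → ℕ
  lab : E → Λ

/-- A marked Petri net over transition (label) type `Λ` with places `P`:
`pre p t = W(p,t)`, `post t p = W(t,p)`, `m0` the initial marking. -/
structure PNet (Λ P : Type) where
  pre : P → Λ → ℕ
  post : Λ → P → ℕ
  m0 : P → ℕ

/-- Inflow of tokens to a transition `e` under a marking (token trail) `x`. -/
def inFlow {Λ C E : Type} [Fintype C] (L : LNet Λ C E) (x : C → ℕ) (e : E) : ℕ :=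
  ∑ c, L.arcIn c e * x c

/-- Outflow of tokens from a transition `e` under a marking (token trail) `x`. -/
def outFlow {Λ C E : Type} [Fintype C] (L : LNet Λ C E) (x : C → ℕ) (e : E) : ℕ :=
  ∑ c, L.arcOut e c * x c

/-- The token trail `x` on the labelled net `L` is valid for the place `p` of `N`. -/
def ValidTrail {Λ C E P : Type} [Fintype C] (N : PNet Λ P) (p : P)
    (L : LNet Λ C E) (x : C → ℕ) : Prop :=
  (∀ e, N.pre p (L.lab e) ≤ inFlow L x e) ∧
  (∀ e, (outFlow L x e : ℤ) =
      (inFlow L x e : ℤ) + N.post (L.lab e) p - N.pre p (L.lab e)) ∧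
  (∑ c, L.i0 c * x c = N.m0 p)

/-- The labelled net `L` is enabled in `N` (i.e. `L ∈ 𝓛(N)`):
for every place there is a valid token trail. -/
def Enabled {Λ C E P : Type} [Fintype C] (N : PNet Λ P) (L : LNet Λ C E) : Prop :=
  ∀ p, ∃ x : C → ℕ, ValidTrail N p L x

/-- A token trail region in a family `L` of labelled nets (indexed by `ι`, which makes
the place and transition sets pairwise disjoint): a marking `r` of the union of the
place sets such that (IV) equally labelled transitions have the same rise and
(V) all nets have the same initial sum of tokens. -/
def IsRegion {Λ ι : Type} {C E : ι → Type} [∀ ν, Fintype (C ν)]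
    (L : ∀ ν, LNet Λ (C ν) (E ν)) (r : ∀ ν, C ν → ℕ) : Prop :=
  (∀ ν μ (e : E ν) (e' : E μ), (L ν).lab e = (L μ).lab e' →
      (outFlow (L ν) (r ν) e : ℤ) - (inFlow (L ν) (r ν) e : ℤ)
        = (outFlow (L μ) (r μ) e' : ℤ) - (inFlow (L μ) (r μ) e' : ℤ)) ∧
  (∀ ν μ, ∑ c, (L ν).i0 c * r ν c = ∑ c, (L μ).i0 c * r μ c)

/-- `N` is the one-place Petri net associated with the region `r`
(its unique place being the element of `Unit`, `ν₀` playing the role of the first net):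
for every label `t` occurring in the family (witnessed by some transition `e`), there is a
transition `e'` labelled `t` with minimal inflow such that `W(p,t) = in_r(e')` and
`W(t,p) = out_r(e')`, and the initial marking is the initial sum of tokens of the net `ν₀`. -/
def IsAssociated {Λ ι : Type} {C E : ι → Type} [∀ ν, Fintype (C ν)]
    (L : ∀ ν, LNet Λ (C ν) (E ν)) (r : ∀ ν, C ν → ℕ) (ν₀ : ι)
    (N : PNet Λ Unit) : Prop :=
  (∀ ν (e : E ν), ∃ (μ : ι) (e' : E μ), (L μ).lab e' = (L ν).lab e ∧
      (∀ σ (e'' : E σ), (L σ).lab e'' = (L ν).lab e →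
        inFlow (L μ) (r μ) e' ≤ inFlow (L σ) (r σ) e'') ∧
      N.pre () ((L ν).lab e) = inFlow (L μ) (r μ) e' ∧
      N.post ((L ν).lab e) () = outFlow (L μ) (r μ) e') ∧
  N.m0 () = ∑ c, (L ν₀).i0 c * r ν₀ c

/-- A valid token trail for a place stays valid for a place with smaller consumption,
the same rise and the same initial marking. -/
theorem ValidTrail.mono {Λ C E P P' : Type} [Fintype C] {N : PNet Λ P} {N' : PNet Λ P'}
    {p : P} {p' : P'} {L : LNet Λ C E} {x : C → ℕ} (h : ValidTrail N' p' L x)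
    (hpre : ∀ t, N.pre p t ≤ N'.pre p' t)
    (hrise : ∀ t, (N'.post t p' : ℤ) - N'.pre p' t = (N.post t p : ℤ) - N.pre p t)
    (hm : N'.m0 p' = N.m0 p) : ValidTrail N p L x := by
  refine ⟨fun e => (hpre _).trans (h.1 e), fun e => ?_, h.2.2.trans hm⟩
  have h₁ := h.2.1 e
  have h₂ := hrise (L.lab e)
  omega

/-- For trails valid for the place `p`, every label `t` admits arc weights with the rise of `p`
that are bounded below by the consumption of `p` and above by the inflow of every transition
labelled `t`, and that are attained by such a transition if there is one. -/
theorem exists_minimal_weights {Λ ι P : Type} {C E : ι → Type} [∀ ν, Fintype (C ν)]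
    {L : ∀ ν, LNet Λ (C ν) (E ν)} {N : PNet Λ P} {p : P} {r : ∀ ν, C ν → ℕ}
    (hr : ∀ ν, ValidTrail N p (L ν) (r ν)) (t : Λ) :
    ∃ a b : ℕ, N.pre p t ≤ a ∧ (b : ℤ) - a = (N.post t p : ℤ) - N.pre p t ∧
      (∀ ν (e : E ν), (L ν).lab e = t → a ≤ inFlow (L ν) (r ν) e) ∧
      (∀ ν (e : E ν), (L ν).lab e = t → ∃ (μ : ι) (e' : E μ), (L μ).lab e' = t ∧
        a = inFlow (L μ) (r μ) e' ∧ b = outFlow (L μ) (r μ) e') := by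
  by_cases h : ∃ (n : ℕ) (ν : ι) (e : E ν), (L ν).lab e = t ∧ inFlow (L ν) (r ν) e = n
  · classical
    obtain ⟨μ, e', rfl, hin⟩ := Nat.find_spec h
    refine ⟨inFlow (L μ) (r μ) e', outFlow (L μ) (r μ) e', (hr μ).1 e', ?_, fun ν e he => ?_,
      fun _ _ _ => ⟨μ, e', rfl, rfl, rfl⟩⟩
    · have := (hr μ).2.1 e'
      omega
    · rw [hin]
      exact Nat.find_min' h ⟨ν, e, he, rfl⟩
  · exact ⟨N.pre p t, N.post t p, le_rfl, rfl, fun ν e he => (h ⟨_, ν, e, he, rfl⟩).elim,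
      fun ν e he => (h ⟨_, ν, e, he, rfl⟩).elim⟩

/-- If every labelled net of a finite family `S = L` is enabled in a
one-place marked Petri net `N`, then there is a token trail region `r` in `S` whose
associated one-place Petri net `N'` satisfies `S ⊆ 𝓛(N') ⊆ 𝓛(N)`. -/
theorem stmt4 {Λ ι : Type} [Fintype ι] {C E : ι → Type} [∀ ν, Fintype (C ν)]
    (L : ∀ ν, LNet Λ (C ν) (E ν)) (ν₀ : ι) (N : PNet Λ Unit)
    (hS : ∀ ν, Enabled N (L ν)) :
    ∃ (r : ∀ ν, C ν → ℕ) (N' : PNet Λ Unit),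
      IsRegion L r ∧ IsAssociated L r ν₀ N' ∧
      (∀ ν, Enabled N' (L ν)) ∧
      (∀ (C' E' : Type) [Fintype C'] (M : LNet Λ C' E'),
        Enabled N' M → Enabled N M) := by
  choose r hr using fun ν => hS ν ()
  choose a b hpre hrise hmin hatt using exists_minimal_weights hr
  refine ⟨r, ⟨fun _ => a, fun t _ => b t, N.m0⟩, ⟨fun ν μ e e' he => ?_, fun ν μ => ?_⟩,
    ⟨fun ν e => ?_, (hr ν₀).2.2.symm⟩, fun ν _ => ⟨r ν, ?_, fun e => ?_, (hr ν).2.2⟩,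
    fun C' E' _ M hM p => ?_⟩
  · have h₁ := (hr ν).2.1 e
    have h₂ := (hr μ).2.1 e'
    rw [he] at h₁
    omega
  · exact (hr ν).2.2.trans (hr μ).2.2.symm
  · obtain ⟨μ, e', he', hin, hout⟩ := hatt _ ν e rfl
    exact ⟨μ, e', he', fun σ e'' h => hin ▸ hmin _ σ e'' h, hin, hout⟩
  · exact fun e => hmin _ ν e rfl
  · have h₁ := (hr ν).2.1 e
    have h₂ := hrise ((L ν).lab e)
    dsimp only
    omega
  · obtain ⟨x, hx⟩ := hM p
    exact ⟨x, hx.mono hpre hrise rfl⟩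
end

section
/- Let S be a finite set of labelled nets over a common label set with pairwise disjoint sets of places and transitions, and let N = (P,T,W,m₀) be any marked Petri net such that every labelled net of S is enabled in N. If L is a labelled net that is enabled in the one-place Petri net N_r associated with r for every token trail region r in S, then L is enabled in N. -/
/-- Valid trails for a place `p` form a region: rises are those of `p`, initial sums are `m0 p`. -/
theorem isRegion_of_validTrail {Λ ι P : Type} {C E : ι → Type} [∀ ν, Fintype (C ν)]
    {L : ∀ ν, LNet Λ (C ν) (E ν)} {N : PNet Λ P} {p : P} {r : ∀ ν, C ν → ℕ}
    (hr : ∀ ν, ValidTrail N p (L ν) (r ν)) : IsRegion L r := by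
  refine ⟨fun ν μ e e' h => ?_, fun ν μ => (hr ν).2.2.trans (hr μ).2.2.symm⟩
  have h₁ := (hr ν).2.1 e
  have h₂ := (hr μ).2.1 e'
  rw [h] at h₁
  omega

/-- A region of valid trails for `p` has an associated one-place net with the rises and the
initial marking of `p`, and whose place consumes at least as much as `p`. -/
theorem exists_isAssociated_of_validTrail {Λ ι P : Type} {C E : ι → Type} [∀ ν, Fintype (C ν)]
    {L : ∀ ν, LNet Λ (C ν) (E ν)} {N : PNet Λ P} {p : P} {r : ∀ ν, C ν → ℕ} (ν₀ : ι)
    (hr : ∀ ν, ValidTrail N p (L ν) (r ν)) :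
    ∃ Nr : PNet Λ Unit, IsAssociated L r ν₀ Nr ∧ Nr.m0 () = N.m0 p ∧
      (∀ t, N.pre p t ≤ Nr.pre () t) ∧
      ∀ t, (Nr.post t () : ℤ) - Nr.pre () t = (N.post t p : ℤ) - N.pre p t := by
  have key : ∀ t, ∃ a b : ℕ, N.pre p t ≤ a ∧ (b : ℤ) - a = (N.post t p : ℤ) - N.pre p t ∧
      ∀ ν (e : E ν), (L ν).lab e = t → ∃ (μ : ι) (e' : E μ), (L μ).lab e' = t ∧
        (∀ σ (e'' : E σ), (L σ).lab e'' = t →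
          inFlow (L μ) (r μ) e' ≤ inFlow (L σ) (r σ) e'') ∧
        a = inFlow (L μ) (r μ) e' ∧ b = outFlow (L μ) (r μ) e' := by
    intro t
    by_cases ht : ∃ q : Σ ν, E ν, (L q.1).lab q.2 = t
    · obtain ⟨⟨μ, e'⟩, he', hmin⟩ := exists_minimalFor_of_wellFoundedLT
        (fun q : Σ ν, E ν => (L q.1).lab q.2 = t) (fun q => inFlow (L q.1) (r q.1) q.2) ht
      have h₁ := (hr μ).1 e'
      have h₂ := (hr μ).2.1 e'
      dsimp only at he'
      rw [he'] at h₁ h₂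
      refine ⟨_, _, h₁, by omega, fun _ _ _ => ⟨μ, e', he', fun σ e'' h => ?_, rfl, rfl⟩⟩
      exact (le_total _ _).elim id (hmin (j := ⟨σ, e''⟩) h)
    · exact ⟨_, _, le_rfl, rfl, fun ν e h => (ht ⟨⟨ν, e⟩, h⟩).elim⟩
  choose a b hle hrise hassoc using key
  exact ⟨⟨fun _ => a, fun t _ => b t, fun _ => N.m0 p⟩,
    ⟨fun ν e => hassoc _ ν e rfl, (hr ν₀).2.2.symm⟩, rfl, hle, hrise⟩

/-- Let `N` be any marked Petri net in which every labelled net of a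
finite family `S = L` is enabled. If a labelled net `M` is enabled in the one-place
Petri net associated with `r` for every token trail region `r` in `S`, then `M` is
enabled in `N`. -/
theorem stmt7 {Λ ι P : Type} [Fintype ι] {C E : ι → Type} [∀ ν, Fintype (C ν)]
    (L : ∀ ν, LNet Λ (C ν) (E ν)) (ν₀ : ι) (N : PNet Λ P)
    (hS : ∀ ν, Enabled N (L ν))
    {C' E' : Type} [Fintype C'] (M : LNet Λ C' E')
    (hM : ∀ (r : ∀ ν, C ν → ℕ) (Nr : PNet Λ Unit),
        IsRegion L r → IsAssociated L r ν₀ Nr → Enabled Nr M) :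
    Enabled N M := by
  intro p
  choose r hr using fun ν => hS ν p
  obtain ⟨Nr, hNr, hm, hpre, hrise⟩ := exists_isAssociated_of_validTrail ν₀ hr
  obtain ⟨x, hin, hout, hinit⟩ := hM r Nr (isRegion_of_validTrail hr) hNr ()
  refine ⟨x, fun e => (hpre _).trans (hin e), fun e => ?_, hinit.trans hm⟩
  have h₁ := hout e
  have h₂ := hrise (M.lab e)
  omega
end
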